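/- Let K be a positive integer and let Φ ∈ ℝ^{M×N} satisfy the restricted isometry property of order K+1 with constant δ < 1/(√K + 1). Then the RIP inequalities of order 3⌈K/2⌉ hold for Φ with the constant 3δ, and 3δ < 3/(√K + 1). (Equivalently: if the RIP inequalities of order 3⌈K/2⌉ fail for every constant smaller than 3/(√K+1), then the RIP inequalities of order K+1 fail for every constant smaller than 1/(√K+1).) -/

import Mathlib

open Finset

/-- The Euclidean (ℓ²) norm of a vector in ℝⁿ. -/
noncomputable def l2norm {n : ℕ} (v : Fin n → ℝ) : ℝ := Real.sqrt (∑ i, v i ^ 2)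

/-- The Euclidean inner product on ℝᵐ. -/
noncomputable def dot {m : ℕ} (u v : Fin m → ℝ) : ℝ := ∑ k, u k * v k

/-- `x` has at most `s` nonzero entries. -/
noncomputable def sparse {n : ℕ} (s : ℕ) (x : Fin n → ℝ) : Prop :=
  (Finset.univ.filter (fun i => x i ≠ 0)).card ≤ s

/-- `Φ` satisfies the restricted isometry property of order `s` with constant `δ`. -/
noncomputable def RIP {M N : ℕ} (Φ : Matrix (Fin M) (Fin N) ℝ) (s : ℕ) (δ : ℝ) : Prop :=
  ∀ x : Fin N → ℝ, sparse s x →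
    (1 - δ) * l2norm x ^ 2 ≤ l2norm (Φ.mulVec x) ^ 2 ∧
    l2norm (Φ.mulVec x) ^ 2 ≤ (1 + δ) * l2norm x ^ 2

theorem l2norm_sq_eq {n : ℕ} (v : Fin n → ℝ) : l2norm v ^ 2 = ∑ i, v i ^ 2 :=
  Real.sq_sqrt (Finset.sum_nonneg fun i _ => sq_nonneg (v i))

theorem l2norm_three {n : ℕ} (a b c : Fin n → ℝ) :
    l2norm (a + b + c) ^ 2 = l2norm (a + b) ^ 2 + l2norm (a + c) ^ 2 + l2norm (b + c) ^ 2
      - l2norm a ^ 2 - l2norm b ^ 2 - l2norm c ^ 2 := by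
  simp only [l2norm_sq_eq, ← Finset.sum_add_distrib, ← Finset.sum_sub_distrib]
  refine Finset.sum_congr rfl fun i _ => ?_
  simp only [Pi.add_apply]
  ring

theorem l2norm_add_disj {n : ℕ} (a b : Fin n → ℝ) (h : ∀ i, a i * b i = 0) :
    l2norm (a + b) ^ 2 = l2norm a ^ 2 + l2norm b ^ 2 := by
  simp only [l2norm_sq_eq, ← Finset.sum_add_distrib]
  refine Finset.sum_congr rfl fun i _ => ?_
  simp only [Pi.add_apply]
  linear_combination 2 * h i

theorem sparse_of_subset {n s : ℕ} (x : Fin n → ℝ) (T : Finset (Fin n))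
    (hT : T.card ≤ s) (h : ∀ i, i ∉ T → x i = 0) : sparse s x := by
  refine le_trans (Finset.card_le_card ?_) hT
  intro i hi
  by_contra hc
  exact (Finset.mem_filter.1 hi).2 (h i hc)

theorem split_three {n : ℕ} (m : ℕ) (S : Finset (Fin n)) (hS : S.card ≤ 3 * m) :
    ∃ A B C : Finset (Fin n), A.card ≤ m ∧ B.card ≤ m ∧ C.card ≤ m ∧
      Disjoint A B ∧ Disjoint A C ∧ Disjoint B C ∧ S = A ∪ B ∪ C := by
  obtain ⟨A, hA, hAc⟩ := Finset.exists_subset_card_eq (s := S) (n := min m S.card) (by omega)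
  have h1 := Finset.card_sdiff_of_subset hA
  obtain ⟨B, hB, hBc⟩ := Finset.exists_subset_card_eq (s := S \ A)
    (n := min m (S \ A).card) (by omega)
  have h2 := Finset.card_sdiff_of_subset hB
  refine ⟨A, B, (S \ A) \ B, by omega, by omega, by omega, ?_, ?_, ?_, ?_⟩
  · exact Finset.disjoint_of_subset_right hB Finset.disjoint_sdiff
  · exact Finset.disjoint_of_subset_right Finset.sdiff_subset Finset.disjoint_sdiff
  · exact Finset.disjoint_sdiff
  · ext i
    have := @hA i
    have := @hB i
    simp only [Finset.mem_union, Finset.mem_sdiff] at *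
    tauto

/-- Remark 1: if `K ≥ 1` and `Φ` has RIP of order `K+1` with constant
`δ < 1/(√K+1)`, then the RIP inequalities of order `3⌈K/2⌉` hold with constant `3δ`,
and `3δ < 3/(√K+1)`. -/
theorem stmt_4 {M N : ℕ} (K : ℕ) (hK : 0 < K)
    (Φ : Matrix (Fin M) (Fin N) ℝ) (δ : ℝ) (hδ0 : 0 < δ)
    (hδ : δ < 1 / (Real.sqrt K + 1)) (hRIP : RIP Φ (K + 1) δ) :
    (∀ x : Fin N → ℝ, sparse (3 * ((K + 1) / 2)) x →
      (1 - 3 * δ) * l2norm x ^ 2 ≤ l2norm (Φ.mulVec x) ^ 2 ∧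
      l2norm (Φ.mulVec x) ^ 2 ≤ (1 + 3 * δ) * l2norm x ^ 2) ∧
    3 * δ < 3 / (Real.sqrt K + 1) := by
  refine ⟨fun x hx => ?_, ?_⟩
  · obtain ⟨A, B, C, hA, hB, hC, hAB, hAC, hBC, hS⟩ := split_three _ _ hx
    have res : ∀ T : Finset (Fin N), ∃ y : Fin N → ℝ,
        (∀ i, i ∈ T → y i = x i) ∧ ∀ i, i ∉ T → y i = 0 := fun T =>
      ⟨fun i => if i ∈ T then x i else 0, fun i hi => if_pos hi, fun i hi => if_neg hi⟩
    obtain ⟨a, ha, ha0⟩ := res A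
    obtain ⟨b, hb, hb0⟩ := res B
    obtain ⟨c, hc, hc0⟩ := res C
    have disj : ∀ (T U : Finset (Fin N)) (y z : Fin N → ℝ), Disjoint T U →
        (∀ i, i ∉ T → y i = 0) → (∀ i, i ∉ U → z i = 0) → ∀ i, y i * z i = 0 := by
      intro T U y z hd hy hz i
      by_cases h : i ∈ T
      · rw [hz i (Finset.disjoint_left.1 hd h), mul_zero]
      · rw [hy i h, zero_mul]
    have sp1 : ∀ (T : Finset (Fin N)) (y : Fin N → ℝ), T.card ≤ (K + 1) / 2 →
        (∀ i, i ∉ T → y i = 0) → sparse (K + 1) y := fun T y hT hy =>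
      sparse_of_subset y T (by omega) hy
    have sp2 : ∀ (T U : Finset (Fin N)) (y z : Fin N → ℝ), T.card ≤ (K + 1) / 2 →
        U.card ≤ (K + 1) / 2 → (∀ i, i ∉ T → y i = 0) → (∀ i, i ∉ U → z i = 0) →
        sparse (K + 1) (y + z) := by
      intro T U y z hT hU hy hz
      refine sparse_of_subset _ (T ∪ U) ?_ ?_
      · have := Finset.card_union_le T U
        omega
      · intro i hi
        rw [Finset.mem_union, not_or] at hi
        simp [hy i hi.1, hz i hi.2]
    have hx3 : x = a + b + c := by
      funext i
      simp only [Pi.add_apply]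
      have hi : x i ≠ 0 ↔ i ∈ A ∪ B ∪ C := by rw [← hS]; simp
      simp only [Finset.mem_union] at hi
      by_cases h1 : i ∈ A
      · rw [ha i h1, hb0 i (Finset.disjoint_left.1 hAB h1),
          hc0 i (Finset.disjoint_left.1 hAC h1)]; ring
      by_cases h2 : i ∈ B
      · rw [ha0 i h1, hb i h2, hc0 i (Finset.disjoint_left.1 hBC h2)]; ring
      by_cases h3 : i ∈ C
      · rw [ha0 i h1, hb0 i h2, hc i h3]; ring
      · have : x i = 0 := by by_contra h; have := hi.1 h; tauto
        rw [ha0 i h1, hb0 i h2, hc0 i h3, this]; ring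
    have nab := l2norm_add_disj a b (disj A B a b hAB ha0 hb0)
    have nac := l2norm_add_disj a c (disj A C a c hAC ha0 hc0)
    have nbc := l2norm_add_disj b c (disj B C b c hBC hb0 hc0)
    have n3 := l2norm_three a b c
    have q3 := l2norm_three (Φ.mulVec a) (Φ.mulVec b) (Φ.mulVec c)
    have ra := hRIP a (sp1 A a hA ha0)
    have rb := hRIP b (sp1 B b hB hb0)
    have rc := hRIP c (sp1 C c hC hc0)
    have rab := hRIP _ (sp2 A B a b hA hB ha0 hb0)
    have rac := hRIP _ (sp2 A C a c hA hC ha0 hc0)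
    have rbc := hRIP _ (sp2 B C b c hB hC hb0 hc0)
    rw [nab, Matrix.mulVec_add] at rab
    rw [nac, Matrix.mulVec_add] at rac
    rw [nbc, Matrix.mulVec_add] at rbc
    rw [nab, nac, nbc] at n3
    rw [hx3, Matrix.mulVec_add, Matrix.mulVec_add, n3, q3]
    constructor <;> linarith [ra.1, ra.2, rb.1, rb.2, rc.1, rc.2, rab.1, rab.2, rac.1, rac.2,
      rbc.1, rbc.2]
  · have h : 3 / (Real.sqrt K + 1) = 3 * (1 / (Real.sqrt K + 1)) := by ring
    rw [h]
    linarith
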